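/- arXiv:2003.09337 — 6 statements merged into one kernel-verified Lean document; each statement's English description precedes it below -/
import Mathlib

section
/- There exists a constant C > 0 such that for every finitely supported sequence of complex numbers (a_k)_{k ∈ ℤ}, the function F(x,t) = Σ_{k ∈ ℤ} a_k · exp(i(k·x + k⁴·t)) satisfies (∫₀^{2π} ∫₀^{2π} |F(x,t)|⁴ dx dt)^{1/4} ≤ C · (Σ_{k ∈ ℤ} |a_k|²)^{1/2}. -/
open MeasureTheory Real Complex

lemma integral_exp_I_mul_int (n : ℤ) :
    ∫ x in (0:ℝ)..(2*Real.pi), Complex.exp (Complex.I * n * x) =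
      if n = 0 then 2 * (Real.pi : ℂ) else 0 := by
  split_ifs with h
  · simp [h]
  · have hn : Complex.I * (n:ℂ) ≠ 0 := mul_ne_zero Complex.I_ne_zero (by exact_mod_cast h)
    rw [integral_exp_mul_complex hn]
    have h1 : Complex.exp (Complex.I * n * ((2 * Real.pi : ℝ) : ℂ)) = 1 := by
      rw [Complex.exp_eq_one_iff]
      exact ⟨n, by push_cast; ring⟩
    rw [h1]
    simp

/-- An unordered pair of integers is determined by its sum and its sum of fourth powers. -/
lemma eq_or_swap_of_add_eq_of_pow_four_add_eq {k l m n : ℤ} (h1 : k + l = m + n)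
    (h4 : k ^ 4 + l ^ 4 = m ^ 4 + n ^ 4) : (m = k ∧ n = l) ∨ (m = l ∧ n = k) := by
  have hn : n = k + l - m := by linarith
  subst hn
  have key : (m - k) * (m - l) *
      (6 * (k + l) ^ 2 + (k - l) ^ 2 + (m - (k + l - m)) ^ 2) = 0 := by
    linear_combination (-2) * h4
  rcases mul_eq_zero.mp key with h | h
  · rcases mul_eq_zero.mp h with h | h
    · left; constructor <;> linarith
    · right; constructor <;> linarith
  · have hs : k + l = 0 := by
      apply pow_eq_zero_iff (n := 2) (by norm_num) |>.mp
      nlinarith [sq_nonneg (k + l), sq_nonneg (k - l), sq_nonneg (m - (k + l - m))]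
    have hd : k - l = 0 := by
      apply pow_eq_zero_iff (n := 2) (by norm_num) |>.mp
      nlinarith [sq_nonneg (k + l), sq_nonneg (k - l), sq_nonneg (m - (k + l - m))]
    have hm : m - (k + l - m) = 0 := by
      apply pow_eq_zero_iff (n := 2) (by norm_num) |>.mp
      nlinarith [sq_nonneg (k + l), sq_nonneg (k - l), sq_nonneg (m - (k + l - m))]
    left; constructor <;> omega

/-- The double integral of a finite trigonometric sum over the torus picks out the zero frequency. -/
lemma integral_integral_sum_exp {ι : Type*} (s : Finset ι) (c : ι → ℂ) (N M : ι → ℤ) :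
    ∫ t in (0:ℝ)..(2*Real.pi), ∫ x in (0:ℝ)..(2*Real.pi),
        ∑ q ∈ s, c q * (Complex.exp (Complex.I * N q * x) * Complex.exp (Complex.I * M q * t)) =
      ∑ q ∈ s, if N q = 0 ∧ M q = 0 then c q * (2 * Real.pi) ^ 2 else 0 := by
  have inner (t : ℝ) : ∫ x in (0:ℝ)..(2*Real.pi),
        ∑ q ∈ s, c q * (Complex.exp (Complex.I * N q * x) * Complex.exp (Complex.I * M q * t)) =
      ∑ q ∈ s, c q * ((if N q = 0 then 2 * (Real.pi : ℂ) else 0) *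
        Complex.exp (Complex.I * M q * t)) := by
    rw [intervalIntegral.integral_finsetSum fun q _ ↦
      (by fun_prop : Continuous _).intervalIntegrable _ _]
    simp_rw [intervalIntegral.integral_const_mul, intervalIntegral.integral_mul_const,
      integral_exp_I_mul_int]
  simp_rw [inner]
  rw [intervalIntegral.integral_finsetSum fun q _ ↦
    (by fun_prop : Continuous _).intervalIntegrable _ _]
  simp_rw [intervalIntegral.integral_const_mul, integral_exp_I_mul_int]
  refine Finset.sum_congr rfl fun q _ ↦ ?_
  by_cases hN : N q = 0 <;> by_cases hM : M q = 0 <;> simp [hN, hM]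
  ring_nf; simp

lemma norm_pow_four_sum_exp (s : Finset ℤ) (a : ℤ → ℂ) (x t : ℝ) :
    ((‖∑ k ∈ s, a k * Complex.exp (Complex.I * ((k:ℂ) * x + (k:ℂ)^4 * t))‖ ^ 4 : ℝ) : ℂ) =
      ∑ q ∈ (s ×ˢ s) ×ˢ (s ×ˢ s),
        (a q.1.1 * a q.1.2 * (starRingEnd ℂ (a q.2.1) * starRingEnd ℂ (a q.2.2))) *
        (Complex.exp (Complex.I * (q.1.1 + q.1.2 - (q.2.1 + q.2.2) : ℤ) * x) *
          Complex.exp (Complex.I *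
            (q.1.1 ^ 4 + q.1.2 ^ 4 - (q.2.1 ^ 4 + q.2.2 ^ 4) : ℤ) * t)) := by
  have h (z : ℂ) : ((‖z‖ ^ 4 : ℝ) : ℂ) = (z * z) * (starRingEnd ℂ z * starRingEnd ℂ z) := by
    have := Complex.mul_conj' z
    push_cast
    linear_combination (-(z * starRingEnd ℂ z) - (‖z‖ : ℂ) ^ 2) * this
  rw [h, map_sum, Finset.sum_mul_sum, Finset.sum_mul_sum, ← Finset.sum_product',
    ← Finset.sum_product', Finset.sum_mul_sum, ← Finset.sum_product']
  refine Finset.sum_congr rfl fun q _ ↦ ?_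
  simp only [map_mul, ← Complex.exp_conj, map_add, map_pow, Complex.conj_I, Complex.conj_ofReal,
    map_intCast]
  have e (A B C D a b c d : ℂ) : A * Complex.exp a * (B * Complex.exp b) *
      (C * Complex.exp c * (D * Complex.exp d)) =
      A * B * (C * D) * Complex.exp (a + b + (c + d)) := by
    simp only [Complex.exp_add]; ring
  rw [e, ← Complex.exp_add]
  congr 2
  push_cast
  ring

lemma sum_mul_of_pow_four_add_eq_le (s : Finset ℤ) (b : ℤ → ℝ) :
    ∑ q ∈ (s ×ˢ s) ×ˢ (s ×ˢ s),
      (if q.1.1 + q.1.2 - (q.2.1 + q.2.2) = 0 ∧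
          q.1.1 ^ 4 + q.1.2 ^ 4 - (q.2.1 ^ 4 + q.2.2 ^ 4) = 0
        then b q.1.1 * b q.1.2 * (b q.2.1 * b q.2.2) else 0) ≤
      2 * (∑ k ∈ s, b k ^ 2) ^ 2 := by
  have hsq : (∑ k ∈ s, b k ^ 2) ^ 2 = ∑ p ∈ s ×ˢ s, b p.1 ^ 2 * b p.2 ^ 2 := by
    rw [sq, Finset.sum_mul_sum, ← Finset.sum_product']
  rw [Finset.sum_product, hsq, Finset.mul_sum]
  refine Finset.sum_le_sum fun p hp ↦ ?_
  have hp' : p.swap ∈ s ×ˢ s := by simpa [and_comm] using hp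
  calc _ ≤ ∑ r ∈ s ×ˢ s, ((if r = p then b p.1 ^ 2 * b p.2 ^ 2 else 0) +
          (if r = p.swap then b p.1 ^ 2 * b p.2 ^ 2 else 0)) := by
        refine Finset.sum_le_sum fun r _ ↦ ?_
        have h0 : 0 ≤ b p.1 ^ 2 * b p.2 ^ 2 := by positivity
        split_ifs with h h1 h2 h2 <;> try positivity
        · subst h1; dsimp only; nlinarith
        · subst h1; dsimp only; nlinarith
        · subst h2; dsimp only [Prod.swap]; nlinarith
        · exfalso
          rcases eq_or_swap_of_add_eq_of_pow_four_add_eq (sub_eq_zero.mp h.1)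
            (sub_eq_zero.mp h.2) with h' | h'
          · exact h1 (Prod.ext h'.1 h'.2)
          · exact h2 (Prod.ext h'.1 h'.2)
    _ = _ := by
        rw [Finset.sum_add_distrib, Finset.sum_ite_eq', Finset.sum_ite_eq', if_pos hp, if_pos hp']
        ring

lemma integral_norm_pow_four_le (s : Finset ℤ) (a : ℤ → ℂ) :
    ∫ t in (0:ℝ)..(2*Real.pi), ∫ x in (0:ℝ)..(2*Real.pi),
        ‖∑ k ∈ s, a k * Complex.exp (Complex.I * ((k:ℂ) * x + (k:ℂ)^4 * t))‖^4 ≤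
      2 * (2 * Real.pi) ^ 2 * (∑ k ∈ s, ‖a k‖ ^ 2) ^ 2 := by
  refine (le_abs_self _).trans ?_
  rw [← Real.norm_eq_abs, ← Complex.norm_real, ← intervalIntegral.integral_ofReal]
  simp_rw [← intervalIntegral.integral_ofReal, norm_pow_four_sum_exp]
  rw [integral_integral_sum_exp]
  refine (norm_sum_le _ _).trans ?_
  have := mul_le_mul_of_nonneg_left
    (sum_mul_of_pow_four_add_eq_le s fun k ↦ ‖a k‖)
    (sq_nonneg (2 * Real.pi))
  refine le_trans (le_of_eq ?_) (this.trans_eq (by ring))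
  rw [Finset.mul_sum]
  refine Finset.sum_congr rfl fun q _ ↦ ?_
  split_ifs
  · simp only [norm_mul, norm_pow, RCLike.norm_conj, Complex.norm_ofNat, Complex.norm_real,
      Real.norm_eq_abs, abs_of_pos Real.pi_pos]
    ring
  · simp

/-- The set {(k, k⁴) : k ∈ ℤ} has bounded Λ(4)-constant (Lemma p2.1). -/
theorem lambda4_constant_bounded :
    ∃ C > (0:ℝ), ∀ a : ℤ →₀ ℂ,
      (∫ t in (0:ℝ)..(2*Real.pi), ∫ x in (0:ℝ)..(2*Real.pi),
        ‖∑ k ∈ a.support, a k * Complex.exp (Complex.I * ((k:ℂ) * x + (k:ℂ)^4 * t))‖^4)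
          ^ ((1:ℝ)/4)
      ≤ C * (∑ k ∈ a.support, ‖a k‖^2) ^ ((1:ℝ)/2) := by
  refine ⟨(2 * (2 * Real.pi) ^ 2) ^ ((1:ℝ)/4), by positivity, fun a ↦ ?_⟩
  have hS : 0 ≤ ∑ k ∈ a.support, ‖a k‖ ^ 2 := by positivity
  have hI : 0 ≤ ∫ t in (0:ℝ)..(2*Real.pi), ∫ x in (0:ℝ)..(2*Real.pi),
      ‖∑ k ∈ a.support, a k * Complex.exp (Complex.I * ((k:ℂ) * x + (k:ℂ)^4 * t))‖^4 :=
    intervalIntegral.integral_nonneg (by positivity) fun t _ ↦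
      intervalIntegral.integral_nonneg (by positivity) fun x _ ↦ by positivity
  refine (Real.rpow_le_rpow hI (integral_norm_pow_four_le a.support a) (by norm_num)).trans_eq ?_
  rw [Real.mul_rpow (by positivity) (by positivity), ← Real.rpow_natCast (∑ k ∈ _, _) 2,
    ← Real.rpow_mul hS]
  norm_num
end

section
/- There exists an absolute constant C > 0 such that for all integers m and n and every natural number j, the number of integers m₁ satisfying |n − m₁⁴ − (m − m₁)⁴| < 2^j is at most C · 2^{j/2}. -/
/-- On either side of its axis of symmetry `x = m / 2`, the function `x ↦ x⁴ + (m - x)⁴` separates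
points at least as much as `2 x⁴` does near the origin. -/
theorem two_mul_sub_pow_four_le_abs (m x y : ℤ) (h : 0 ≤ (2 * x - m) * (2 * y - m)) :
    2 * (x - y) ^ 4 ≤ |(x ^ 4 + (m - x) ^ 4) - (y ^ 4 + (m - y) ^ 4)| := by
  obtain ⟨u, hu⟩ : ∃ u, u = 2 * x - m := ⟨_, rfl⟩
  obtain ⟨v, hv⟩ : ∃ v, v = 2 * y - m := ⟨_, rfl⟩
  rw [← hu, ← hv] at h
  have hdiff : 8 * ((x ^ 4 + (m - x) ^ 4) - (y ^ 4 + (m - y) ^ 4)) =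
      (u ^ 2 - v ^ 2) * (u ^ 2 + v ^ 2 + 6 * m ^ 2) := by subst hu hv; ring
  have hpow : 16 * (x - y) ^ 4 = ((u - v) ^ 2) ^ 2 := by subst hu hv; ring
  have habs : 8 * |(x ^ 4 + (m - x) ^ 4) - (y ^ 4 + (m - y) ^ 4)| =
      |u ^ 2 - v ^ 2| * (u ^ 2 + v ^ 2 + 6 * m ^ 2) := by
    have hpos : 0 ≤ u ^ 2 + v ^ 2 + 6 * m ^ 2 := by positivity
    rw [← abs_of_nonneg hpos, ← abs_mul, ← hdiff, abs_mul]
    rfl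
  have hsq : (u - v) ^ 2 ≤ |u ^ 2 - v ^ 2| := by
    have hle : |u - v| ≤ |u + v| := sq_le_sq.mp (by nlinarith)
    calc (u - v) ^ 2 = |u - v| * |u - v| := by rw [abs_mul_abs_self, sq]
      _ ≤ |u + v| * |u - v| := by gcongr
      _ = |u ^ 2 - v ^ 2| := by rw [← abs_mul]; congr 1; ring
  have hsum : (u - v) ^ 2 ≤ u ^ 2 + v ^ 2 + 6 * m ^ 2 := by nlinarith [sq_nonneg m]
  have hmul := mul_le_mul hsq hsum (sq_nonneg _) (abs_nonneg _)
  rw [← habs, ← sq, ← hpow] at hmul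
  linarith

/-- A set of integers of diameter at most `K` is finite with at most `2 * K + 1` elements. -/
theorem Set.finite_and_ncard_le_of_abs_sub_le {S : Set ℤ} {K : ℕ}
    (h : ∀ x ∈ S, ∀ y ∈ S, |x - y| ≤ K) : S.Finite ∧ S.ncard ≤ 2 * K + 1 := by
  obtain rfl | ⟨a, ha⟩ := S.eq_empty_or_nonempty
  · simp
  have hsub : S ⊆ (Finset.Icc (a - K) (a + K) : Finset ℤ) := fun x hx => by
    have := abs_le.mp (h x hx a ha)
    simp only [Finset.coe_Icc, Set.mem_Icc]
    omega
  refine ⟨(Finset.finite_toSet _).subset hsub, ?_⟩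
  have hcard := Set.ncard_le_ncard hsub (Finset.finite_toSet _)
  rw [Set.ncard_coe_finset, Int.card_Icc] at hcard
  omega

/-- An integer whose fourth power is less than `2 ^ j` is at most `2 ^ (j / 2)` in absolute
value. -/
theorem Int.abs_le_floor_two_rpow_half {d : ℤ} {j : ℕ} (h : d ^ 4 < 2 ^ j) :
    |d| ≤ (⌊(2 : ℝ) ^ ((j : ℝ) / 2)⌋₊ : ℤ) := by
  have hsq : d ^ 2 ≤ 2 ^ j := by
    have : d ^ 2 ≤ (d ^ 2) ^ 2 := Int.le_self_sq _
    nlinarith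
  have hr : ((2 : ℝ) ^ ((j : ℝ) / 2)) ^ 2 = 2 ^ j := by
    rw [← Real.rpow_natCast, ← Real.rpow_mul (by norm_num), ← Real.rpow_natCast]
    congr 1
    push_cast
    ring
  rw [Int.abs_eq_natAbs, Nat.cast_le, Nat.le_floor_iff (by positivity), Nat.cast_natAbs,
    Int.cast_abs]
  refine abs_le_of_sq_le_sq ?_ (by positivity)
  rw [hr]
  exact_mod_cast hsq

/-- The counting claim (display (6.4)): for fixed m, n ∈ ℤ, the number of
integers m₁ with |n − m₁⁴ − (m − m₁)⁴| < 2^j is at most C · 2^{j/2}. -/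
theorem level_set_count_bound :
    ∃ C > (0:ℝ), ∀ m n : ℤ, ∀ j : ℕ,
      {m₁ : ℤ | |n - m₁^4 - (m - m₁)^4| < 2^j}.Finite ∧
      (({m₁ : ℤ | |n - m₁^4 - (m - m₁)^4| < 2^j}.ncard : ℝ))
        ≤ C * (2:ℝ) ^ ((j:ℝ)/2) := by
  refine ⟨6, by norm_num, fun m n j => ?_⟩
  set S := {m₁ : ℤ | |n - m₁^4 - (m - m₁)^4| < 2^j} with hS
  set K := ⌊(2 : ℝ) ^ ((j : ℝ) / 2)⌋₊
  have hdist : ∀ x ∈ S, ∀ y ∈ S, 0 ≤ (2 * x - m) * (2 * y - m) → |x - y| ≤ (K : ℤ) := by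
    intro x hx y hy hxy
    apply Int.abs_le_floor_two_rpow_half
    have hlow := two_mul_sub_pow_four_le_abs m x y hxy
    have hup : |(x ^ 4 + (m - x) ^ 4) - (y ^ 4 + (m - y) ^ 4)| < 2 * 2 ^ j := by
      simp only [hS, Set.mem_ofPred_eq, abs_lt] at hx hy
      rw [abs_lt]
      constructor <;> linarith
    linarith
  obtain ⟨hRfin, hRcard⟩ := Set.finite_and_ncard_le_of_abs_sub_le
    (S := {x ∈ S | 0 ≤ 2 * x - m}) (K := K)
    fun x hx y hy => hdist x hx.1 y hy.1 (mul_nonneg hx.2 hy.2)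
  obtain ⟨hLfin, hLcard⟩ := Set.finite_and_ncard_le_of_abs_sub_le
    (S := {x ∈ S | 2 * x - m ≤ 0}) (K := K)
    fun x hx y hy => hdist x hx.1 y hy.1 (mul_nonneg_of_nonpos_of_nonpos hx.2 hy.2)
  have hsub : S ⊆ {x ∈ S | 0 ≤ 2 * x - m} ∪ {x ∈ S | 2 * x - m ≤ 0} := fun x hx =>
    (le_total 0 (2 * x - m)).imp (⟨hx, ·⟩) (⟨hx, ·⟩)
  refine ⟨(hRfin.union hLfin).subset hsub, ?_⟩
  have hcard : S.ncard ≤ 4 * K + 2 := by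
    have := Set.ncard_le_ncard hsub (hRfin.union hLfin)
    have := Set.ncard_union_le {x ∈ S | 0 ≤ 2 * x - m} {x ∈ S | 2 * x - m ≤ 0}
    omega
  have hone : (1 : ℝ) ≤ 2 ^ ((j : ℝ) / 2) := Real.one_le_rpow (by norm_num) (by positivity)
  have hfloor : (K : ℝ) ≤ 2 ^ ((j : ℝ) / 2) := Nat.floor_le (by positivity)
  have hcast : (S.ncard : ℝ) ≤ 4 * K + 2 := by exact_mod_cast hcard
  linarith
end

section
/- Let ψ : ℝ → ℝ be a measurable function with 0 ≤ ψ ≤ 1 and ψ(y) = 1 whenever |y| ≤ 1/2. Then there exists a constant C > 0 (depending only on these properties of ψ) such that for every measurable function f : (0,∞) → ℂ with ∫₀^∞ (μ + 1)³ |f(μ)|² dμ < ∞, one has Σ_{k=1}^∞ | ∫₀^∞ f(μ) · (1 − ψ(μ⁴ − k⁴)) / (μ − k) dμ |² ≤ C · ∫₀^∞ (μ + 1)³ |f(μ)|² dμ. -/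
open MeasureTheory

/-- The total mass of an unnormalised Cauchy density of scale `γ`. -/
lemma lintegral_inv_sq_add_sq (a : ℝ) {γ : ℝ} (hγ : 0 < γ) :
    ∫⁻ x : ℝ, ENNReal.ofReal (((x - a) ^ 2 + γ ^ 2)⁻¹) = ENNReal.ofReal (Real.pi / γ) := by
  lift γ to NNReal using hγ.le
  have hscale : ∀ x : ℝ, ENNReal.ofReal (((x - a) ^ 2 + (γ : ℝ) ^ 2)⁻¹) =
      ENNReal.ofReal (Real.pi / γ) * ProbabilityTheory.cauchyPDF a γ x := by
    intro x
    rw [ProbabilityTheory.cauchyPDF_def, ProbabilityTheory.cauchyPDFReal_def,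
      ← ENNReal.ofReal_mul (by positivity)]
    congr 1
    field_simp
  simp_rw [hscale]
  rw [lintegral_const_mul _ (ProbabilityTheory.measurable_cauchyPDF _ _),
    ProbabilityTheory.lintegral_cauchyPDF_eq_one a (NNReal.coe_pos.1 hγ).ne', mul_one]

/-- Weighted Cauchy–Schwarz inequality for lower Lebesgue integrals. -/
lemma sq_lintegral_ofReal_mul_le {α : Type*} [MeasurableSpace α] {ν : Measure α}
    {g κ w : α → ℝ} (hg : AEMeasurable g ν) (hκ : AEMeasurable κ ν) (hw : AEMeasurable w ν)
    (hw0 : ∀ᵐ x ∂ν, 0 < w x) (hg0 : ∀ x, 0 ≤ g x) (hκ0 : ∀ x, 0 ≤ κ x) :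
    (∫⁻ x, ENNReal.ofReal (g x * κ x) ∂ν) ^ 2 ≤
      (∫⁻ x, ENNReal.ofReal (w x * g x ^ 2) ∂ν) * ∫⁻ x, ENNReal.ofReal (κ x ^ 2 / w x) ∂ν := by
  have hHolder := ENNReal.lintegral_mul_le_Lp_mul_Lq ν Real.HolderConjugate.two_two
    (f := fun x => ENNReal.ofReal (√(w x) * g x)) (g := fun x => ENNReal.ofReal (κ x / √(w x)))
    (by fun_prop) (by fun_prop)
  have hprod : ∫⁻ x, ENNReal.ofReal (g x * κ x) ∂ν =
      ∫⁻ x, ((fun x => ENNReal.ofReal (√(w x) * g x)) *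
        fun x => ENNReal.ofReal (κ x / √(w x))) x ∂ν := by
    refine lintegral_congr_ae ?_
    filter_upwards [hw0] with x hx
    have hs := Real.sqrt_pos.2 hx
    rw [Pi.mul_apply, ← ENNReal.ofReal_mul (mul_nonneg hs.le (hg0 x))]
    congr 1
    field_simp
  have hleft : ∫⁻ x, ENNReal.ofReal (√(w x) * g x) ^ (2 : ℝ) ∂ν =
      ∫⁻ x, ENNReal.ofReal (w x * g x ^ 2) ∂ν := by
    refine lintegral_congr_ae ?_
    filter_upwards [hw0] with x hx
    rw [ENNReal.rpow_two, ← ENNReal.ofReal_pow (mul_nonneg (Real.sqrt_nonneg _) (hg0 x)),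
      mul_pow, Real.sq_sqrt hx.le]
  have hright : ∫⁻ x, ENNReal.ofReal (κ x / √(w x)) ^ (2 : ℝ) ∂ν =
      ∫⁻ x, ENNReal.ofReal (κ x ^ 2 / w x) ∂ν := by
    refine lintegral_congr_ae ?_
    filter_upwards [hw0] with x hx
    rw [ENNReal.rpow_two, ← ENNReal.ofReal_pow (div_nonneg (hκ0 x) (Real.sqrt_nonneg _)),
      div_pow, Real.sq_sqrt hx.le]
  rw [hprod]
  refine (pow_le_pow_left' hHolder 2).trans_eq ?_
  rw [hleft, hright, mul_pow, ← ENNReal.rpow_two, ← ENNReal.rpow_two, ← ENNReal.rpow_mul,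
    ← ENNReal.rpow_mul]
  norm_num

/-- The excised kernel close to the diagonal is dominated by a Cauchy density of scale `k⁻³`. -/
lemma near_kernel_le {μ k c : ℝ} (hk : 1 ≤ k) (hμ : |μ - k| < 1 / 2) (hc0 : 0 ≤ c) (hc1 : c ≤ 1)
    (hcut : |μ ^ 4 - k ^ 4| ≤ 1 / 2 → c = 0) :
    (c / |μ - k|) ^ 2 / (μ + 1) ^ 3 ≤
      2 / k ^ 3 * ((μ - k) ^ 2 + (1 / (18 * k ^ 3)) ^ 2)⁻¹ := by
  by_cases h : |μ ^ 4 - k ^ 4| ≤ 1 / 2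
  · rw [hcut h]
    simp only [zero_div, ne_eq, OfNat.ofNat_ne_zero, not_false_eq_true, zero_pow]
    positivity
  push Not at h
  have hμ' := abs_lt.1 hμ
  have hkμ : k ≤ μ + 1 := by linarith
  have hfac : |μ ^ 4 - k ^ 4| ≤ |μ - k| * (9 * k ^ 3) := by
    rw [show μ ^ 4 - k ^ 4 = (μ - k) * ((μ + k) * (μ ^ 2 + k ^ 2)) by ring, abs_mul]
    have hμ0 : 0 ≤ μ := by linarith
    rw [abs_of_nonneg (a := (μ + k) * (μ ^ 2 + k ^ 2)) (by positivity)]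
    refine mul_le_mul_of_nonneg_left ?_ (abs_nonneg _)
    have h1 : μ + k ≤ 5 / 2 * k := by linarith
    have h2 : μ ^ 2 ≤ (3 / 2 * k) ^ 2 := by gcongr; linarith
    calc (μ + k) * (μ ^ 2 + k ^ 2) ≤ (5 / 2 * k) * ((3 / 2 * k) ^ 2 + k ^ 2) := by gcongr
      _ = 65 / 8 * k ^ 3 := by ring
      _ ≤ 9 * k ^ 3 := by gcongr; norm_num
  have hgap : 1 / (18 * k ^ 3) ≤ |μ - k| := by
    rw [div_le_iff₀ (by positivity)]
    linarith
  have hδ : 0 < 1 / (18 * k ^ 3) := by positivity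
  have hpos : 0 < |μ - k| := hδ.trans_le hgap
  have hsq : (1 / (18 * k ^ 3)) ^ 2 ≤ (μ - k) ^ 2 := by
    rw [← sq_abs (μ - k)]
    gcongr
  have hsq0 : 0 < (μ - k) ^ 2 := by rw [← sq_abs]; positivity
  rw [div_pow, sq_abs]
  calc c ^ 2 / (μ - k) ^ 2 / (μ + 1) ^ 3 ≤ 1 / (μ - k) ^ 2 / k ^ 3 := by
        gcongr
        exact pow_le_one₀ hc0 hc1
    _ = 2 / k ^ 3 * (2 * (μ - k) ^ 2)⁻¹ := by field_simp
    _ ≤ _ := by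
        gcongr
        linarith

/-- The weighted kernel away from the diagonal decays like `k⁻²`. -/
lemma far_kernel_le {μ k c : ℝ} (hk : 1 ≤ k) (hμ0 : 0 < μ) (hμ : 1 / 2 ≤ |μ - k|)
    (hc0 : 0 ≤ c) (hc1 : c ≤ 1) :
    (c / |μ - k|) ^ 2 / (μ + 1) ^ 3 ≤
      20 / k ^ 2 * (((μ - 0) ^ 2 + 1 ^ 2)⁻¹ + ((μ - k) ^ 2 + 1 ^ 2)⁻¹) := by
  have hsq : 1 / 4 ≤ (μ - k) ^ 2 := by
    rw [← sq_abs (μ - k)]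
    nlinarith
  have hsq0 : 0 < (μ - k) ^ 2 := by linarith
  have hA : 0 ≤ ((μ - 0) ^ 2 + 1 ^ 2)⁻¹ := by positivity
  have hB : 0 ≤ ((μ - k) ^ 2 + 1 ^ 2)⁻¹ := by positivity
  have hk0 : 0 < k := by linarith
  rw [div_pow, sq_abs]
  have hc : c ^ 2 / (μ - k) ^ 2 / (μ + 1) ^ 3 ≤ 1 / (μ - k) ^ 2 / (μ + 1) ^ 3 := by
    gcongr
    exact pow_le_one₀ hc0 hc1
  refine hc.trans ?_
  rcases le_total μ (k / 2) with h | h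
  · have h1 : k ^ 2 / 4 ≤ (μ - k) ^ 2 := by nlinarith
    have h2 : (μ - 0) ^ 2 + 1 ^ 2 ≤ (μ + 1) ^ 3 := by nlinarith [pow_pos hμ0 3, pow_pos hμ0 2]
    calc 1 / (μ - k) ^ 2 / (μ + 1) ^ 3 ≤ 1 / (k ^ 2 / 4) / ((μ - 0) ^ 2 + 1 ^ 2) := by gcongr
      _ = 4 / k ^ 2 * ((μ - 0) ^ 2 + 1 ^ 2)⁻¹ := by field_simp
      _ ≤ 20 / k ^ 2 * (((μ - 0) ^ 2 + 1 ^ 2)⁻¹ + ((μ - k) ^ 2 + 1 ^ 2)⁻¹) := by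
        gcongr
        · norm_num
        · linarith
  · have h1 : ((μ - k) ^ 2 + 1 ^ 2) / 5 ≤ (μ - k) ^ 2 := by linarith
    have h2 : k ^ 2 / 4 ≤ (μ + 1) ^ 3 := by nlinarith [pow_pos hμ0 3, pow_pos hμ0 2]
    calc 1 / (μ - k) ^ 2 / (μ + 1) ^ 3 ≤ 1 / (((μ - k) ^ 2 + 1 ^ 2) / 5) / (k ^ 2 / 4) := by
          gcongr
      _ = 20 / k ^ 2 * ((μ - k) ^ 2 + 1 ^ 2)⁻¹ := by field_simp; norm_num
      _ ≤ 20 / k ^ 2 * (((μ - 0) ^ 2 + 1 ^ 2)⁻¹ + ((μ - k) ^ 2 + 1 ^ 2)⁻¹) := by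
        gcongr
        linarith

lemma lintegral_near_kernel_le {k : ℝ} (hk : 1 ≤ k) {c : ℝ → ℝ} (hc0 : ∀ μ, 0 ≤ c μ)
    (hc1 : ∀ μ, c μ ≤ 1) (hcut : ∀ μ, |μ ^ 4 - k ^ 4| ≤ 1 / 2 → c μ = 0) :
    ∫⁻ μ in Metric.ball k (1 / 2), ENNReal.ofReal ((c μ / |μ - k|) ^ 2 / (μ + 1) ^ 3) ≤
      ENNReal.ofReal (36 * Real.pi) := by
  have hk0 : 0 < k := by linarith
  calc _ ≤ ∫⁻ μ in Metric.ball k (1 / 2), ENNReal.ofReal (2 / k ^ 3) *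
          ENNReal.ofReal (((μ - k) ^ 2 + (1 / (18 * k ^ 3)) ^ 2)⁻¹) := by
        refine setLIntegral_mono' measurableSet_ball fun μ hμ => ?_
        rw [← ENNReal.ofReal_mul (by positivity)]
        rw [Metric.mem_ball, Real.dist_eq] at hμ
        exact ENNReal.ofReal_le_ofReal (near_kernel_le hk hμ (hc0 μ) (hc1 μ) (hcut μ))
    _ ≤ ∫⁻ μ, ENNReal.ofReal (2 / k ^ 3) *
          ENNReal.ofReal (((μ - k) ^ 2 + (1 / (18 * k ^ 3)) ^ 2)⁻¹) := setLIntegral_le_lintegral _ _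
    _ = ENNReal.ofReal (36 * Real.pi) := by
        rw [lintegral_const_mul _ (by fun_prop), lintegral_inv_sq_add_sq k (by positivity),
          ← ENNReal.ofReal_mul (by positivity)]
        congr 1
        field_simp
        norm_num

lemma lintegral_far_kernel_le {k : ℝ} (hk : 1 ≤ k) {c : ℝ → ℝ} (hc0 : ∀ μ, 0 ≤ c μ)
    (hc1 : ∀ μ, c μ ≤ 1) :
    ∫⁻ μ in Set.Ioi 0 \ Metric.ball k (1 / 2),
        ENNReal.ofReal ((c μ / |μ - k|) ^ 2 / (μ + 1) ^ 3) ≤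
      ENNReal.ofReal (40 * Real.pi * (1 / k ^ 2)) := by
  have hk0 : 0 < k := by linarith
  calc _ ≤ ∫⁻ μ in Set.Ioi 0 \ Metric.ball k (1 / 2), ENNReal.ofReal (20 / k ^ 2) *
          (ENNReal.ofReal (((μ - 0) ^ 2 + 1 ^ 2)⁻¹) +
            ENNReal.ofReal (((μ - k) ^ 2 + 1 ^ 2)⁻¹)) := by
        refine setLIntegral_mono' (measurableSet_Ioi.diff measurableSet_ball) fun μ hμ => ?_
        rw [← ENNReal.ofReal_add (by positivity) (by positivity),
          ← ENNReal.ofReal_mul (by positivity)]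
        have hfar := hμ.2
        rw [Metric.mem_ball, Real.dist_eq, not_lt] at hfar
        exact ENNReal.ofReal_le_ofReal (far_kernel_le hk hμ.1 hfar (hc0 μ) (hc1 μ))
    _ ≤ ∫⁻ μ, ENNReal.ofReal (20 / k ^ 2) *
          (ENNReal.ofReal (((μ - 0) ^ 2 + 1 ^ 2)⁻¹) +
            ENNReal.ofReal (((μ - k) ^ 2 + 1 ^ 2)⁻¹)) := setLIntegral_le_lintegral _ _
    _ = ENNReal.ofReal (40 * Real.pi * (1 / k ^ 2)) := by
        rw [lintegral_const_mul _ (by fun_prop), lintegral_add_left (by fun_prop),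
          lintegral_inv_sq_add_sq 0 one_pos, lintegral_inv_sq_add_sq k one_pos,
          ← ENNReal.ofReal_add (by positivity) (by positivity),
          ← ENNReal.ofReal_mul (by positivity)]
        congr 1
        ring

lemma ball_half_subset_Ioi {k : ℝ} (hk : 1 ≤ k) : Metric.ball k (1 / 2) ⊆ Set.Ioi (0 : ℝ) := by
  intro μ hμ
  rw [Metric.mem_ball, Real.dist_eq] at hμ
  have := (abs_lt.1 hμ).1
  rw [Set.mem_Ioi]
  linarith

lemma sq_add_le_two_mul_add_sq (x y : ENNReal) : (x + y) ^ 2 ≤ 2 * (x ^ 2 + y ^ 2) := by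
  have h := ENNReal.rpow_add_le_mul_rpow_add_rpow x y one_le_two
  norm_num at h
  exact h

/-- The square of a single off-diagonal integral, bounded by a local and a decaying global part. -/
lemma sq_lintegral_kernel_le {k : ℝ} (hk : 1 ≤ k) {c g : ℝ → ℝ} (hc : Measurable c)
    (hg : Measurable g) (hg0 : ∀ μ, 0 ≤ g μ) (hc0 : ∀ μ, 0 ≤ c μ) (hc1 : ∀ μ, c μ ≤ 1)
    (hcut : ∀ μ, |μ ^ 4 - k ^ 4| ≤ 1 / 2 → c μ = 0) :
    (∫⁻ μ in Set.Ioi 0, ENNReal.ofReal (g μ * (c μ / |μ - k|))) ^ 2 ≤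
      2 * ((∫⁻ μ in Metric.ball k (1 / 2), ENNReal.ofReal ((μ + 1) ^ 3 * g μ ^ 2)) *
          ENNReal.ofReal (36 * Real.pi) +
        (∫⁻ μ in Set.Ioi 0, ENNReal.ofReal ((μ + 1) ^ 3 * g μ ^ 2)) *
          ENNReal.ofReal (40 * Real.pi * (1 / k ^ 2))) := by
  have hball := ball_half_subset_Ioi hk
  have hCS : ∀ s : Set ℝ, MeasurableSet s → s ⊆ Set.Ioi 0 →
      (∫⁻ μ in s, ENNReal.ofReal (g μ * (c μ / |μ - k|))) ^ 2 ≤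
        (∫⁻ μ in s, ENNReal.ofReal ((μ + 1) ^ 3 * g μ ^ 2)) *
          ∫⁻ μ in s, ENNReal.ofReal ((c μ / |μ - k|) ^ 2 / (μ + 1) ^ 3) := by
    intro s hs hs0
    refine sq_lintegral_ofReal_mul_le (w := fun μ => (μ + 1) ^ 3) hg.aemeasurable
      (Measurable.aemeasurable (by fun_prop)) (by fun_prop) ?_ hg0
      fun μ => div_nonneg (hc0 μ) (abs_nonneg _)
    filter_upwards [ae_restrict_mem hs] with μ hμ
    have : 0 < μ := hs0 hμ
    positivity
  rw [← lintegral_inter_add_sdiff _ (Set.Ioi 0) (measurableSet_ball (x := k) (ε := 1 / 2)),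
    Set.inter_eq_self_of_subset_right hball]
  refine (sq_add_le_two_mul_add_sq _ _).trans ?_
  gcongr
  · exact (hCS _ measurableSet_ball hball).trans
      (mul_le_mul_right (lintegral_near_kernel_le hk hc0 hc1 hcut) _)
  · refine (hCS _ (measurableSet_Ioi.diff measurableSet_ball) Set.sdiff_subset).trans ?_
    exact mul_le_mul' (lintegral_mono_set Set.sdiff_subset) (lintegral_far_kernel_le hk hc0 hc1)

/-- Half-unit balls around the positive integers are disjoint subsets of the half-line. -/
lemma tsum_lintegral_ball_le (G : ℝ → ENNReal) :
    ∑' k : ℕ+, ∫⁻ μ in Metric.ball (k : ℝ) (1 / 2), G μ ≤ ∫⁻ μ in Set.Ioi 0, G μ := by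
  rw [← lintegral_iUnion (fun _ => measurableSet_ball)]
  · exact lintegral_mono_set
      (Set.iUnion_subset fun k => ball_half_subset_Ioi (Nat.one_le_cast.2 k.pos))
  · intro i j hij
    refine Metric.ball_disjoint_ball ?_
    rw [Nat.dist_cast_real]
    have := Nat.pairwise_one_le_dist (PNat.coe_injective.ne hij)
    linarith

/-- Lemma A-1-1: weighted ℓ² estimate for the off-diagonal kernel 1/(μ − k)
with the resonance |μ⁴ − k⁴| ≤ 1/2 excised by the cutoff ψ. -/
theorem offdiagonal_kernel_estimate
    (ψ : ℝ → ℝ) (hψmeas : Measurable ψ)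
    (hψ0 : ∀ y, 0 ≤ ψ y) (hψ1 : ∀ y, ψ y ≤ 1)
    (hψcut : ∀ y : ℝ, |y| ≤ 1/2 → ψ y = 1) :
    ∃ C > (0:ℝ), ∀ f : ℝ → ℂ, Measurable f →
      IntegrableOn (fun μ : ℝ => (μ + 1)^3 * ‖f μ‖^2) (Set.Ioi 0) →
      (∑' k : ℕ+,
        ‖∫ μ in Set.Ioi (0:ℝ),
            f μ * (1 - (ψ (μ^4 - (k:ℝ)^4) : ℂ)) / ((μ:ℂ) - (k:ℝ))‖^2)
      ≤ C * ∫ μ in Set.Ioi (0:ℝ), (μ + 1)^3 * ‖f μ‖^2 := by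
  have hsum : Summable fun k : ℕ+ => 40 * Real.pi * (1 / (k : ℝ) ^ 2) :=
    ((Real.summable_one_div_nat_pow.2 one_lt_two).comp_injective PNat.coe_injective).mul_left _
  set S : ℝ := ∑' k : ℕ+, 40 * Real.pi * (1 / (k : ℝ) ^ 2) with hS
  have hS0 : 0 ≤ S := tsum_nonneg fun k => by positivity
  refine ⟨2 * (36 * Real.pi + S), by positivity, fun f hf hint => ?_⟩
  have hmass : ENNReal.ofReal (∫ μ in Set.Ioi (0:ℝ), (μ + 1) ^ 3 * ‖f μ‖ ^ 2) =
      ∫⁻ μ in Set.Ioi 0, ENNReal.ofReal ((μ + 1) ^ 3 * ‖f μ‖ ^ 2) := by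
    refine ofReal_integral_eq_lintegral_ofReal hint ?_
    filter_upwards [ae_restrict_mem measurableSet_Ioi] with μ hμ
    have : 0 < μ := hμ
    simp only [Pi.zero_apply]
    positivity
  have hterm : ∀ k : ℕ+, ‖∫ μ in Set.Ioi (0:ℝ),
      f μ * (1 - (ψ (μ^4 - (k:ℝ)^4) : ℂ)) / ((μ:ℂ) - (k:ℝ))‖ₑ ^ 2 ≤
      2 * ((∫⁻ μ in Metric.ball (k : ℝ) (1 / 2), ENNReal.ofReal ((μ + 1) ^ 3 * ‖f μ‖ ^ 2)) *
          ENNReal.ofReal (36 * Real.pi) +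
        (∫⁻ μ in Set.Ioi 0, ENNReal.ofReal ((μ + 1) ^ 3 * ‖f μ‖ ^ 2)) *
          ENNReal.ofReal (40 * Real.pi * (1 / (k : ℝ) ^ 2))) := by
    intro k
    refine le_trans ?_ (sq_lintegral_kernel_le (k := k) (c := fun μ => 1 - ψ (μ ^ 4 - (k : ℝ) ^ 4))
      (g := fun μ => ‖f μ‖) (Nat.one_le_cast.2 k.pos) (by fun_prop) hf.norm
      (fun _ => norm_nonneg _) (fun _ => sub_nonneg.2 (hψ1 _))
      (fun _ => sub_le_self _ (hψ0 _)) fun μ hμ => by simp only [hψcut _ hμ, sub_self])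
    gcongr
    refine (enorm_integral_le_lintegral_enorm _).trans_eq (lintegral_congr fun μ => ?_)
    rw [← ofReal_norm, norm_div, norm_mul, mul_div_assoc]
    norm_cast
    rw [Real.norm_eq_abs, Real.norm_eq_abs,
      abs_of_nonneg (sub_nonneg.2 (hψ1 _))]
  have htotal : ∑' k : ℕ+, ‖∫ μ in Set.Ioi (0:ℝ),
      f μ * (1 - (ψ (μ^4 - (k:ℝ)^4) : ℂ)) / ((μ:ℂ) - (k:ℝ))‖ₑ ^ 2 ≤
      ENNReal.ofReal (2 * (36 * Real.pi + S) *
        ∫ μ in Set.Ioi (0:ℝ), (μ + 1) ^ 3 * ‖f μ‖ ^ 2) := by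
    refine (ENNReal.tsum_le_tsum hterm).trans ?_
    rw [ENNReal.tsum_mul_left, ENNReal.tsum_add, ENNReal.tsum_mul_right, ENNReal.tsum_mul_left,
      ← ENNReal.ofReal_tsum_of_nonneg (fun k => by positivity) hsum, ← hS,
      ENNReal.ofReal_mul (p := 2 * (36 * Real.pi + S)) (by positivity),
      ENNReal.ofReal_mul (p := 2) (by positivity), ENNReal.ofReal_add (by positivity) hS0, hmass,
      ENNReal.ofReal_ofNat, mul_assoc, add_mul,
      mul_comm (ENNReal.ofReal S), mul_comm (ENNReal.ofReal (36 * Real.pi))]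
    gcongr
    exact tsum_lintegral_ball_le _
  have hI0 : 0 ≤ ∫ μ in Set.Ioi (0:ℝ), (μ + 1) ^ 3 * ‖f μ‖ ^ 2 :=
    setIntegral_nonneg measurableSet_Ioi fun μ hμ => by
      have : 0 < μ := hμ
      positivity
  have hreal := ENNReal.toReal_le_of_le_ofReal (by positivity) htotal
  rw [ENNReal.tsum_toReal_eq fun k => by finiteness] at hreal
  simpa only [ENNReal.toReal_pow, toReal_enorm] using hreal
end

section
/- For every real number s > 1/2 there exists a constant C > 0 such that for every integer k ≥ 2, ∫₀^{k−1} dμ / ( (μ + 1)^{2s} · (μ − k)² ) ≤ C · k^{−2·min(s,1)}. -/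
theorem integral_rpow_neg_le {p K : ℝ} (hp : 1 < p) (hK : 1 ≤ K) :
    ∫ x in (1 : ℝ)..K, x ^ (-p) ≤ 1 / (p - 1) := by
  have h0 : (0 : ℝ) ∉ Set.uIcc 1 K := by
    rw [Set.uIcc_of_le hK]
    exact fun h => absurd h.1 (by norm_num)
  rw [integral_rpow (Or.inr ⟨by linarith, h0⟩), Real.one_rpow,
    ← neg_div_neg_eq, show -(-p + 1) = p - 1 by ring]
  have : 0 ≤ K ^ (-p + 1) := by positivity
  exact div_le_div_of_nonneg_right (by linarith) (by linarith)

/-- If two numbers at least `1` have sum at least `K`, one of them is at least `K / 2`, and the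
corresponding factor of the product decays at the rate given by the smaller exponent `m`. -/
theorem rpow_neg_mul_rpow_neg_le {a b K p q m : ℝ} (ha : 1 ≤ a) (hb : 1 ≤ b) (hK : 0 < K)
    (hab : K ≤ a + b) (hm : 0 ≤ m) (hmp : m ≤ p) (hmq : m ≤ q) :
    a ^ (-p) * b ^ (-q) ≤ (K / 2) ^ (-m) * (a ^ (-p) + b ^ (-q)) := by
  have decay : ∀ {x r : ℝ}, 1 ≤ x → m ≤ r → K / 2 ≤ x → x ^ (-r) ≤ (K / 2) ^ (-m) := by
    intro x r hx hr hKx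
    exact (Real.rpow_le_rpow_of_exponent_le hx (neg_le_neg hr)).trans
      (Real.rpow_le_rpow_of_nonpos (by linarith) hKx (by linarith))
  have hA : 0 ≤ a ^ (-p) := by positivity
  have hB : 0 ≤ b ^ (-q) := by positivity
  have hC : 0 ≤ (K / 2) ^ (-m) := by positivity
  rcases le_total (K / 2) a with h | h
  · nlinarith [mul_le_mul_of_nonneg_right (decay ha hmp h) hB, mul_nonneg hC hA]
  · nlinarith [mul_le_mul_of_nonneg_left (decay hb hmq (by linarith)) hA, mul_nonneg hC hB]

/-- Quantitative decay estimate used in the proof of Lemma A-1-1: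
∫₀^{k−1} (μ+1)^{−2s}(μ−k)^{−2} dμ ≤ C · k^{−2 min(s,1)} for s > 1/2. -/
theorem integral_decay_estimate (s : ℝ) (hs : 1/2 < s) :
    ∃ C > (0:ℝ), ∀ k : ℕ, 2 ≤ k →
      (∫ μ in (0:ℝ)..((k:ℝ) - 1), 1 / ((μ + 1) ^ (2*s) * (μ - (k:ℝ))^2))
        ≤ C * (k:ℝ) ^ (-2 * min s 1) := by
  have hs' : 0 < 2 * s - 1 := by linarith
  refine ⟨2 ^ (2 * min s 1) * (1 / (2 * s - 1) + 1), by positivity, fun k hk => ?_⟩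
  have hk2 : (2 : ℝ) ≤ k := by exact_mod_cast hk
  have hm : 0 ≤ min s 1 := le_min (by linarith) zero_le_one
  have hle : (0 : ℝ) ≤ k - 1 := by linarith
  have cont_left : ContinuousOn (fun μ : ℝ => (μ + 1) ^ (-(2 * s))) (Set.uIcc 0 ((k : ℝ) - 1)) := by
    rw [Set.uIcc_of_le hle]
    exact ContinuousOn.rpow_const (by fun_prop)
      fun μ hμ => Or.inl (by linarith [hμ.1])
  have cont_right : ContinuousOn (fun μ : ℝ => (k - μ) ^ (-2 : ℝ)) (Set.uIcc 0 ((k : ℝ) - 1)) := by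
    rw [Set.uIcc_of_le hle]
    exact ContinuousOn.rpow_const (by fun_prop)
      fun μ hμ => Or.inl (by linarith [hμ.2])
  have int_left : ∫ μ in (0 : ℝ)..(k - 1), (μ + 1) ^ (-(2 * s)) ≤ 1 / (2 * s - 1) := by
    rw [intervalIntegral.integral_comp_add_right (fun x : ℝ => x ^ (-(2 * s)))]
    simpa using integral_rpow_neg_le (p := 2 * s) (K := k) (by linarith) (by linarith)
  have int_right : ∫ μ in (0 : ℝ)..(k - 1), (k - μ) ^ (-2 : ℝ) ≤ 1 := by
    rw [intervalIntegral.integral_comp_sub_left (fun x : ℝ => x ^ (-2 : ℝ))]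
    have h := integral_rpow_neg_le (p := 2) (K := k) (by norm_num) (by linarith)
    rw [sub_sub_cancel, sub_zero]
    exact h.trans_eq (by norm_num)
  calc ∫ μ in (0:ℝ)..((k:ℝ) - 1), 1 / ((μ + 1) ^ (2*s) * (μ - (k:ℝ))^2)
      = ∫ μ in (0:ℝ)..((k:ℝ) - 1), (μ + 1) ^ (-(2 * s)) * (k - μ) ^ (-2 : ℝ) := by
        refine intervalIntegral.integral_congr fun μ hμ => ?_
        rw [Set.uIcc_of_le hle] at hμ
        have h1 : 0 ≤ μ + 1 := by linarith [hμ.1]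
        have h2 : 0 ≤ k - μ := by linarith [hμ.2]
        rw [Real.rpow_neg h1, Real.rpow_neg h2, Real.rpow_two, ← mul_inv, one_div,
          show (μ - k) ^ 2 = (k - μ) ^ 2 by ring]
    _ ≤ ∫ μ in (0:ℝ)..((k:ℝ) - 1), ((k : ℝ) / 2) ^ (-(2 * min s 1)) *
          ((μ + 1) ^ (-(2 * s)) + (k - μ) ^ (-2 : ℝ)) := by
        refine intervalIntegral.integral_mono_on hle
          (cont_left.mul cont_right).intervalIntegrable
          (continuousOn_const.mul (cont_left.add cont_right)).intervalIntegrable fun μ hμ => ?_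
        exact rpow_neg_mul_rpow_neg_le (by linarith [hμ.1]) (by linarith [hμ.2]) (by linarith)
          (by linarith) (by linarith) (by linarith [min_le_left s 1])
          (by linarith [min_le_right s 1])
    _ ≤ ((k : ℝ) / 2) ^ (-(2 * min s 1)) * (1 / (2 * s - 1) + 1) := by
        rw [intervalIntegral.integral_const_mul, intervalIntegral.integral_add
          cont_left.intervalIntegrable cont_right.intervalIntegrable]
        gcongr
    _ = 2 ^ (2 * min s 1) * (1 / (2 * s - 1) + 1) * (k : ℝ) ^ (-2 * min s 1) := by
        rw [Real.div_rpow (by linarith) zero_le_two, Real.rpow_neg zero_le_two, div_inv_eq_mul,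
          neg_mul]
        ring
end

section
/- For every α ∈ (3/4, 1) there exists a constant C > 0 such that for every real λ > 0 and every x ∈ (0,1], the series Σ_{k ∈ ℕ, k⁴ ≥ 2λ} sin(kπx) / (k − λ^{1/4}) converges (its partial sums converge), and its sum S satisfies |S| ≤ C · x^{α−1} · (1 + λ^{1/4})^{α−1}. -/
open Filter Real

/-- Abel's inequality: a nonnegative antitone weight `b` turns a bound `B` on the partial sums of `z`
into the bound `b 0 * B` on the partial sums of `b * z`. -/
theorem abs_sum_range_mul_le_of_antitone {b z : ℕ → ℝ} {B : ℝ} (hb : Antitone b)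
    (hb0 : ∀ n, 0 ≤ b n) (hz : ∀ n, |∑ i ∈ Finset.range n, z i| ≤ B) (n : ℕ) :
    |∑ i ∈ Finset.range n, b i * z i| ≤ b 0 * B := by
  have key : |∑ i ∈ Finset.range n, b i * z i - b n * ∑ i ∈ Finset.range n, z i|
      ≤ (b 0 - b n) * B := by
    induction n with
    | zero => simp
    | succ n ih =>
      have hstep : ∑ i ∈ Finset.range (n + 1), b i * z i
            - b (n + 1) * ∑ i ∈ Finset.range (n + 1), z i
          = (∑ i ∈ Finset.range n, b i * z i - b n * ∑ i ∈ Finset.range n, z i)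
            + (b n - b (n + 1)) * ∑ i ∈ Finset.range (n + 1), z i := by
        simp only [Finset.sum_range_succ]
        ring
      have hle : |(b n - b (n + 1)) * ∑ i ∈ Finset.range (n + 1), z i|
          ≤ (b n - b (n + 1)) * B := by
        have hd : 0 ≤ b n - b (n + 1) := sub_nonneg.2 (hb n.le_succ)
        rw [abs_mul, abs_of_nonneg hd]
        exact mul_le_mul_of_nonneg_left (hz _) hd
      rw [hstep]
      linarith [abs_add_le (∑ i ∈ Finset.range n, b i * z i - b n * ∑ i ∈ Finset.range n, z i)
        ((b n - b (n + 1)) * ∑ i ∈ Finset.range (n + 1), z i)]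
  have hlast : |b n * ∑ i ∈ Finset.range n, z i| ≤ b n * B := by
    rw [abs_mul, abs_of_nonneg (hb0 n)]
    exact mul_le_mul_of_nonneg_left (hz n) (hb0 n)
  linarith [abs_sub_abs_le_abs_sub (∑ i ∈ Finset.range n, b i * z i)
    (b n * ∑ i ∈ Finset.range n, z i)]

theorem two_mul_sin_half_mul_sum_range_sin (a t : ℝ) (n : ℕ) :
    2 * sin (t / 2) * ∑ i ∈ Finset.range n, sin (a + i * t)
      = cos (a - t / 2) - cos (a + n * t - t / 2) := by
  induction n with
  | zero => simp
  | succ n ih =>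
    rw [Finset.sum_range_succ, mul_add, ih]
    have h : a + ((n + 1 : ℕ) : ℝ) * t - t / 2 = a + n * t + t / 2 := by
      push_cast
      ring
    rw [h, cos_sub (a + n * t), cos_add (a + n * t)]
    ring

theorem abs_sum_range_sin_le {x : ℝ} (hx : x ∈ Set.Ioc (0 : ℝ) 1) (M n : ℕ) :
    |∑ i ∈ Finset.range n, sin (((M + i : ℕ) : ℝ) * π * x)| ≤ 1 / x := by
  obtain ⟨hx0, hx1⟩ := hx
  have hsin : x ≤ sin (π * x / 2) := by
    have h := mul_le_sin (x := π * x / 2) (by positivity) (by nlinarith [pi_pos])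
    have h' : 2 / π * (π * x / 2) = x := by field_simp
    rwa [h'] at h
  have hsum : ∑ i ∈ Finset.range n, sin (((M + i : ℕ) : ℝ) * π * x)
      = ∑ i ∈ Finset.range n, sin (M * (π * x) + i * (π * x)) := by
    refine Finset.sum_congr rfl fun i _ => ?_
    push_cast
    ring_nf
  have h := congrArg abs (two_mul_sin_half_mul_sum_range_sin (M * (π * x)) (π * x) n)
  rw [← hsum, abs_mul, abs_of_pos (by linarith : 0 < 2 * sin (π * x / 2))] at h
  have hcos : ∀ u v : ℝ, |cos u - cos v| ≤ 2 := fun u v =>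
    abs_le.2 ⟨by linarith [neg_one_le_cos u, cos_le_one v],
      by linarith [cos_le_one u, neg_one_le_cos v]⟩
  rw [le_div_iff₀ hx0]
  have h2 := h.le.trans (hcos _ _)
  nlinarith [abs_nonneg (∑ i ∈ Finset.range n, sin (((M + i : ℕ) : ℝ) * π * x))]

section ShiftedSeries

variable {μ x : ℝ} {M : ℕ}

theorem antitone_inv_natCast_add_sub (hM : μ < M) :
    Antitone fun i : ℕ => (((M + i : ℕ) : ℝ) - μ)⁻¹ := by
  intro i j hij
  have h : (i : ℝ) ≤ j := by exact_mod_cast hij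
  have hi : (0 : ℝ) ≤ i := i.cast_nonneg
  refine inv_anti₀ ?_ ?_ <;> push_cast <;> linarith

theorem cauchySeq_sum_range_sin_div (hx : x ∈ Set.Ioc (0 : ℝ) 1) (hM : μ < M) :
    CauchySeq fun n : ℕ => ∑ i ∈ Finset.range n,
      sin (((M + i : ℕ) : ℝ) * π * x) / (((M + i : ℕ) : ℝ) - μ) := by
  have hlim : Tendsto (fun i : ℕ => (((M + i : ℕ) : ℝ) - μ)⁻¹) atTop (nhds 0) := by
    refine tendsto_inv_atTop_zero.comp (tendsto_atTop_add_const_right _ (-μ) ?_)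
    exact tendsto_natCast_atTop_atTop.comp (tendsto_atTop_mono (fun i => Nat.le_add_left i M)
      tendsto_id)
  have h := (antitone_inv_natCast_add_sub hM).cauchySeq_series_mul_of_tendsto_zero_of_bounded
    hlim (fun n => (norm_eq_abs _).trans_le (abs_sum_range_sin_le hx M n))
  simpa only [smul_eq_mul, div_eq_inv_mul] using h

theorem abs_sum_range_sin_div_le (hx : x ∈ Set.Ioc (0 : ℝ) 1) (hM0 : 0 < M)
    (hM : μ ≤ 7 / 8 * M) (n : ℕ) :
    |∑ i ∈ Finset.range n, sin (((M + i : ℕ) : ℝ) * π * x) / (((M + i : ℕ) : ℝ) - μ)|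
      ≤ 8 / (M * x) := by
  have hM' : (0 : ℝ) < M := by exact_mod_cast hM0
  have hx0 := hx.1
  have hlt : μ < M := by linarith
  have h := abs_sum_range_mul_le_of_antitone (antitone_inv_natCast_add_sub hlt)
    (fun i => inv_nonneg.2 (by push_cast; linarith [(i.cast_nonneg : (0 : ℝ) ≤ i)]))
    (abs_sum_range_sin_le hx M) n
  simp only [← div_eq_inv_mul] at h
  refine h.trans ?_
  have hinv : ((M : ℝ) - μ)⁻¹ ≤ (M / 8 : ℝ)⁻¹ := inv_anti₀ (by positivity) (by linarith)
  rw [div_eq_inv_mul]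
  calc (((M + 0 : ℕ) : ℝ) - μ)⁻¹ * (1 / x) ≤ (M / 8 : ℝ)⁻¹ * (1 / x) :=
        mul_le_mul_of_nonneg_right hinv (by positivity)
    _ = 8 / (M * x) := by field_simp

theorem abs_sin_div_sub_le (hx0 : 0 < x) (hM0 : 0 < M) (hM : μ ≤ 7 / 8 * M) :
    |sin (M * π * x) / (M - μ)| ≤ 8 * π * x := by
  have hM' : (0 : ℝ) < M := by exact_mod_cast hM0
  have hsin : |sin (M * π * x)| ≤ M * π * x :=
    abs_sin_le_abs.trans_eq (abs_of_pos (by positivity))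
  rw [abs_div, abs_of_pos (by linarith : 0 < (M : ℝ) - μ), div_le_iff₀ (by linarith)]
  nlinarith [mul_pos pi_pos hx0]

theorem abs_sum_range_sin_div_le_const (hx : x ∈ Set.Ioc (0 : ℝ) 1) (hM0 : 0 < M)
    (hM : μ ≤ 7 / 8 * M) (n : ℕ) :
    |∑ i ∈ Finset.range n, sin (((M + i : ℕ) : ℝ) * π * x) / (((M + i : ℕ) : ℝ) - μ)|
      ≤ 64 := by
  obtain ⟨hx0, hx1⟩ := hx
  set L := ⌈1 / x⌉₊
  have hLlow : 1 ≤ L * x := (div_le_iff₀ hx0).1 (Nat.le_ceil (1 / x))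
  have hLup : L * x ≤ 2 := by
    have h := (Nat.ceil_lt_add_one (by positivity : 0 ≤ 1 / x)).le
    calc (L : ℝ) * x ≤ (1 / x + 1) * x := mul_le_mul_of_nonneg_right h hx0.le
      _ = 1 + x := by field_simp
      _ ≤ 2 := by linarith
  have hshift : ∀ i : ℕ, μ ≤ 7 / 8 * ((M + i : ℕ) : ℝ) := fun i => by
    push_cast
    linarith [(i.cast_nonneg : (0 : ℝ) ≤ i)]
  have hhead : ∀ m ≤ L,
      |∑ i ∈ Finset.range m, sin (((M + i : ℕ) : ℝ) * π * x) / (((M + i : ℕ) : ℝ) - μ)|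
        ≤ 56 := by
    intro m hm
    have hm' : (m : ℝ) ≤ L := by exact_mod_cast hm
    calc _ ≤ ∑ i ∈ Finset.range m,
          |sin (((M + i : ℕ) : ℝ) * π * x) / (((M + i : ℕ) : ℝ) - μ)| :=
          Finset.abs_sum_le_sum_abs _ _
      _ ≤ ∑ i ∈ Finset.range m, 8 * π * x :=
          Finset.sum_le_sum fun i _ => abs_sin_div_sub_le hx0 (by omega) (hshift i)
      _ = 8 * π * (m * x) := by
          rw [Finset.sum_const, Finset.card_range, nsmul_eq_mul]
          ring
      _ ≤ 8 * π * 2 := by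
          have : (m : ℝ) * x ≤ 2 := (mul_le_mul_of_nonneg_right hm' hx0.le).trans hLup
          gcongr
      _ ≤ 56 := by linarith [pi_lt_d2]
  rcases le_total n L with hn | hn
  · linarith [hhead n hn]
  · obtain ⟨m, rfl⟩ := Nat.exists_eq_add_of_le hn
    rw [Finset.sum_range_add]
    have htail := abs_sum_range_sin_div_le (M := M + L) ⟨hx0, hx1⟩ (by omega) (hshift L) m
    have h8 : 8 / (((M + L : ℕ) : ℝ) * x) ≤ 8 := by
      have h1 : 1 ≤ ((M + L : ℕ) : ℝ) * x := by
        push_cast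
        nlinarith [mul_nonneg (M.cast_nonneg : (0 : ℝ) ≤ M) hx0.le]
      exact div_le_self (by norm_num) h1
    simp only [add_assoc] at htail ⊢
    linarith [abs_add_le
      (∑ i ∈ Finset.range L, sin (((M + i : ℕ) : ℝ) * π * x) / (((M + i : ℕ) : ℝ) - μ))
      (∑ i ∈ Finset.range m, sin (((M + (L + i) : ℕ) : ℝ) * π * x)
        / (((M + (L + i) : ℕ) : ℝ) - μ)), hhead L le_rfl]

end ShiftedSeries

theorem le_mul_rpow_of_le_of_le_div {s K y β : ℝ} (hK : 0 ≤ K) (hy : 0 < y) (hβ : -1 ≤ β)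
    (hβ0 : β ≤ 0) (h : s ≤ K) (h' : s ≤ K / y) : s ≤ K * y ^ β := by
  rcases le_total y 1 with hy1 | hy1
  · exact h.trans (le_mul_of_one_le_right hK (one_le_rpow_of_pos_of_le_one_of_nonpos hy hy1 hβ0))
  · refine h'.trans ?_
    rw [div_eq_mul_inv, ← rpow_neg_one]
    exact mul_le_mul_of_nonneg_left (rpow_le_rpow_of_exponent_le hy1 hβ) hK

theorem rpow_one_fourth_le_of_two_mul_le_pow {lam k : ℝ} (hlam : 0 ≤ lam) (hk : 0 ≤ k)
    (h : 2 * lam ≤ k ^ 4) : lam ^ ((1 : ℝ) / 4) ≤ 7 / 8 * k := by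
  have h4 : lam ≤ (7 / 8 * k) ^ (4 : ℝ) := by
    rw [show (4 : ℝ) = ((4 : ℕ) : ℝ) by norm_num, rpow_natCast, mul_pow]
    nlinarith [pow_nonneg hk 4]
  rw [one_div]
  exact (rpow_inv_le_iff_of_pos hlam (by positivity) (by norm_num)).2 h4

/-- Lemma p37-middle: the tail sine series Σ_{k⁴ ≥ 2λ} sin(kπx)/(k − λ^{1/4})
converges and is bounded by C · x^{α−1} · (1 + λ^{1/4})^{α−1}. -/
theorem tail_sine_series_bound (α : ℝ) (hα : α ∈ Set.Ioo (3/4 : ℝ) 1) :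
    ∃ C > (0:ℝ), ∀ lam : ℝ, 0 < lam → ∀ x ∈ Set.Ioc (0:ℝ) 1,
      ∃ S : ℝ,
        Tendsto (fun n : ℕ => ∑ k ∈ Finset.range n,
            (if 2 * lam ≤ (k:ℝ)^4 then
              Real.sin (k * Real.pi * x) / ((k:ℝ) - lam ^ ((1:ℝ)/4))
            else 0))
          atTop (nhds S) ∧
        |S| ≤ C * x ^ (α - 1) * (1 + lam ^ ((1:ℝ)/4)) ^ (α - 1) := by
  refine ⟨64, by norm_num, fun lam hlam x hx => ?_⟩
  obtain ⟨hα1, hα2⟩ := hα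
  have hx0 := hx.1
  set μ := lam ^ ((1 : ℝ) / 4)
  have hμ : 0 < μ := rpow_pos_of_pos hlam _
  have hex : ∃ k : ℕ, 2 * lam ≤ (k : ℝ) ^ 4 :=
    ((tendsto_pow_atTop (by norm_num)).comp tendsto_natCast_atTop_atTop).eventually_ge_atTop
      (2 * lam) |>.exists
  classical
  obtain ⟨N, hN, hmin⟩ : ∃ N : ℕ, 2 * lam ≤ (N : ℝ) ^ 4 ∧
      ∀ k < N, ¬ 2 * lam ≤ (k : ℝ) ^ 4 :=
    ⟨Nat.find hex, Nat.find_spec hex, fun _ => Nat.find_min hex⟩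
  have hN0 : 0 < N := Nat.pos_of_ne_zero fun h => by
    rw [h] at hN
    norm_num at hN
    linarith
  have hN1 : (1 : ℝ) ≤ N := by exact_mod_cast hN0
  have hμN : μ ≤ 7 / 8 * N := rpow_one_fourth_le_of_two_mul_le_pow hlam.le N.cast_nonneg hN
  obtain ⟨S, hS⟩ := cauchySeq_tendsto_of_complete
    (cauchySeq_sum_range_sin_div hx (by linarith : μ < N))
  refine ⟨S, ?_, ?_⟩
  · rw [← tendsto_add_atTop_iff_nat N]
    refine hS.congr fun n => ?_
    rw [add_comm n N, Finset.sum_range_add,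
      Finset.sum_eq_zero fun k hk => if_neg (hmin k (Finset.mem_range.1 hk)), zero_add]
    refine Finset.sum_congr rfl fun i _ => (if_pos (hN.trans ?_)).symm
    gcongr
    exact Nat.le_add_right N i
  · rw [mul_assoc, ← mul_rpow hx0.le (by linarith)]
    refine le_mul_rpow_of_le_of_le_div (by norm_num) (by positivity) (by linarith)
      (by linarith) ?_ ?_
    · exact le_of_tendsto' hS.abs (abs_sum_range_sin_div_le_const hx hN0 hμN)
    · refine (le_of_tendsto' hS.abs (abs_sum_range_sin_div_le hx hN0 hμN)).trans ?_
      rw [div_le_div_iff₀ (by positivity) (by positivity)]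
      nlinarith
end

section
/- Let a > 0 be a real number and let c = exp(iπ/4) (so that c² = i). Then sin(c·a·π) ≠ 0 (complex sine), and for every x ∈ (0, π) the series Σ_{k=1}^∞ (k³ + i·k·a²)/(k⁴ + a⁴) · sin(kx) converges (its partial sums converge) with sum equal to (π/2) · sin(c·a·(π − x)) / sin(c·a·π). -/
open Filter Complex

/-- The coefficients `n / (n² - w²)` of the sine series of `sin (w (π - x))`, up to a constant. -/
noncomputable def sineCoeff (w : ℂ) (n : ℤ) : ℂ := n / ((n : ℂ) ^ 2 - w ^ 2)

lemma sineCoeff_neg (w : ℂ) (n : ℤ) : sineCoeff w (-n) = -sineCoeff w n := by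
  simp [sineCoeff, neg_div]

lemma sub_ne_zero_of_mem_integerComplement {w : ℂ} (hw : w ∈ integerComplement) (n : ℤ) :
    (n : ℂ) - w ≠ 0 := fun h => hw ⟨n, sub_eq_zero.1 h⟩

lemma add_ne_zero_of_mem_integerComplement {w : ℂ} (hw : w ∈ integerComplement) (n : ℤ) :
    (n : ℂ) + w ≠ 0 := by
  simpa [add_comm] using integerComplement_add_ne_zero hw n

lemma sq_sub_sq_ne_zero_of_mem_integerComplement {w : ℂ} (hw : w ∈ integerComplement) (n : ℤ) :
    (n : ℂ) ^ 2 - w ^ 2 ≠ 0 := by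
  rw [sq_sub_sq]
  exact mul_ne_zero (add_ne_zero_of_mem_integerComplement hw n)
    (sub_ne_zero_of_mem_integerComplement hw n)

lemma sineCoeff_eq_inv_add_inv {w : ℂ} (hw : w ∈ integerComplement) (n : ℤ) :
    sineCoeff w n = (((n : ℂ) - w)⁻¹ + ((n : ℂ) + w)⁻¹) / 2 := by
  have h₁ := sub_ne_zero_of_mem_integerComplement hw n
  have h₂ := add_ne_zero_of_mem_integerComplement hw n
  rw [sineCoeff, sq_sub_sq]
  field_simp
  ring

lemma summable_sineCoeff_sub {w : ℂ} (hw : w ∈ integerComplement) :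
    Summable fun n : ℤ => sineCoeff w n - sineCoeff w (n - 1) := by
  have key (z : ℂ) : Summable fun n : ℤ => ((z + n) * (z + n - 1))⁻¹ := by
    have h := (EisensteinSeries.summable_linear_right_add_one_mul_linear_right z 1 1).comp_injective
      (Equiv.subRight (1 : ℤ)).injective
    refine h.congr fun n => ?_
    simp only [Function.comp_apply, Equiv.subRight_apply]
    push_cast
    ring_nf
  refine (((key w).add (key (-w))).mul_left (-1 / 2)).congr fun n => ?_
  rw [sineCoeff_eq_inv_add_inv hw, sineCoeff_eq_inv_add_inv hw]
  have h₁ := sub_ne_zero_of_mem_integerComplement hw n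
  have h₂ := add_ne_zero_of_mem_integerComplement hw n
  have h₃ := sub_ne_zero_of_mem_integerComplement hw (n - 1)
  have h₄ := add_ne_zero_of_mem_integerComplement hw (n - 1)
  push_cast at h₃ h₄ ⊢
  rw [show w + n = n + w by ring, show (n : ℂ) + w - 1 = n - 1 + w by ring,
    show -w + n = n - w by ring, show (n : ℂ) - w - 1 = n - 1 - w by ring]
  field_simp
  ring

lemma tendsto_sineCoeff_natCast {w : ℂ} (hw : w ∈ integerComplement) :
    Tendsto (fun n : ℕ => sineCoeff w n) atTop (nhds 0) := by
  have key (z : ℂ) : Tendsto (fun n : ℕ => ((n : ℂ) + z)⁻¹) atTop (nhds 0) :=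
    tendsto_inv₀_cobounded.comp
      ((tendsto_add_const_cobounded z).comp tendsto_natCast_atTop_cobounded)
  simpa [sineCoeff_eq_inv_add_inv hw, sub_eq_add_neg] using ((key (-w)).add (key w)).div_const 2

lemma integral_exp_mul_sin {w : ℂ} (hw : w ∈ integerComplement) (n : ℤ) :
    ∫ t in (0 : ℝ)..2 * Real.pi, exp (-(n * t * I)) * sin (w * (Real.pi - t)) =
      -2 * I * sin (w * Real.pi) * sineCoeff w n := by
  have hD := sq_sub_sq_ne_zero_of_mem_integerComplement hw n
  have hD' : w ^ 2 - (n : ℂ) ^ 2 ≠ 0 := by rw [← neg_sub]; exact neg_ne_zero.2 hD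
  have hderiv (t : ℝ) : HasDerivAt (fun t : ℝ => (w * cos (w * (Real.pi - t))
      - n * I * sin (w * (Real.pi - t))) * exp (-(n * t * I)) / (w ^ 2 - (n : ℂ) ^ 2))
      (exp (-(n * t * I)) * sin (w * (Real.pi - t))) t := by
    have hlin : HasDerivAt (fun z : ℂ => w * (Real.pi - z)) (-w) t := by
      simpa using ((hasDerivAt_id (t : ℂ)).const_sub (Real.pi : ℂ)).const_mul w
    have hexp : HasDerivAt (fun z : ℂ => exp (-(n * z * I)))
        (exp (-(n * t * I)) * (-(n * I))) t := by
      simpa using ((((hasDerivAt_id (t : ℂ)).const_mul (n : ℂ)).mul_const I).neg).cexp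
    refine ((((hlin.ccos.const_mul w).sub (hlin.csin.const_mul (n * I))).mul hexp).div_const
      (w ^ 2 - (n : ℂ) ^ 2)).comp_ofReal.congr_deriv ?_
    rw [div_eq_iff hD', Pi.sub_apply]
    linear_combination ((n : ℂ) ^ 2 * sin (w * (Real.pi - t)) * exp (-(n * t * I))) * I_sq
  rw [intervalIntegral.integral_eq_sub_of_hasDerivAt (fun t _ => hderiv t)
    (Continuous.intervalIntegrable (by fun_prop) _ _)]
  have hexp : exp (-(n * (2 * Real.pi : ℝ) * I)) = 1 := by
    rw [exp_neg, inv_eq_one, ← exp_int_mul_two_pi_mul_I n]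
    push_cast
    ring_nf
  rw [hexp, sineCoeff, show w * ((Real.pi : ℂ) - (2 * Real.pi : ℝ)) = -(w * Real.pi) by
    push_cast; ring]
  simp only [cos_neg, sin_neg, ofReal_zero, sub_zero, mul_zero, zero_mul, neg_zero, exp_zero]
  field_simp
  ring

instance fact_two_pi_pos : Fact (0 < 2 * Real.pi) := ⟨Real.two_pi_pos⟩

/-- Multiplication by `1 - exp (i x)` makes `sin (w (π - x))` continuous on the circle. -/
noncomputable def circleSine (w : ℂ) : C(AddCircle (2 * Real.pi), ℂ) where
  toFun := AddCircle.liftIco (2 * Real.pi) 0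
    fun x : ℝ => (1 - exp (x * I)) * sin (w * (Real.pi - x))
  continuous_toFun := AddCircle.liftIco_zero_continuous (by simp [exp_two_pi_mul_I])
    (by fun_prop)

lemma circleSine_coe_apply (w : ℂ) {x : ℝ} (hx : x ∈ Set.Ico 0 (2 * Real.pi)) :
    circleSine w x = (1 - exp (x * I)) * sin (w * (Real.pi - x)) :=
  AddCircle.liftIco_zero_coe_apply
    (f := fun x : ℝ => (1 - exp (x * I)) * sin (w * (Real.pi - x))) hx

lemma fourier_two_pi_apply (n : ℤ) (x : ℝ) :
    fourier n (x : AddCircle (2 * Real.pi)) = exp (n * x * I) := by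
  rw [fourier_coe_apply]
  congr 1
  have : (Real.pi : ℂ) ≠ 0 := ofReal_ne_zero.2 Real.pi_ne_zero
  push_cast
  field_simp

lemma fourierCoeff_circleSine {w : ℂ} (hw : w ∈ integerComplement) (n : ℤ) :
    fourierCoeff (circleSine w) n =
      -I * sin (w * Real.pi) / Real.pi * (sineCoeff w n - sineCoeff w (n - 1)) := by
  have hπ : (Real.pi : ℂ) ≠ 0 := ofReal_ne_zero.2 Real.pi_ne_zero
  have hint (m : ℤ) : IntervalIntegrable
      (fun t : ℝ => exp (-(m * t * I)) * sin (w * (Real.pi - t))) MeasureTheory.volume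
      0 (2 * Real.pi) := Continuous.intervalIntegrable (by fun_prop) _ _
  have hsplit : ∫ t in (0 : ℝ)..2 * Real.pi, fourier (-n) (t : AddCircle (2 * Real.pi)) •
      ((1 - exp (t * I)) * sin (w * (Real.pi - t))) =
      ∫ t in (0 : ℝ)..2 * Real.pi, (exp (-(n * t * I)) * sin (w * (Real.pi - t)) -
        exp (-((n - 1 : ℤ) * t * I)) * sin (w * (Real.pi - t))) := by
    congr 1 with t
    rw [fourier_two_pi_apply, show -(((n - 1 : ℤ) : ℂ) * t * I) = -(n * t * I) + t * I by
      push_cast; ring, exp_add]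
    push_cast
    rw [smul_eq_mul, neg_mul, neg_mul]
    ring
  have hlift : ∫ t in (0 : ℝ)..2 * Real.pi, fourier (-n) (t : AddCircle (2 * Real.pi)) •
      circleSine w t = ∫ t in (0 : ℝ)..2 * Real.pi, fourier (-n) (t : AddCircle (2 * Real.pi)) •
      ((1 - exp (t * I)) * sin (w * (Real.pi - t))) :=
    intervalIntegral.integral_congr_Ioo_of_le Real.two_pi_pos.le fun t ht => by
      rw [circleSine_coe_apply w (Set.Ioo_subset_Ico_self ht)]
  rw [fourierCoeff_eq_intervalIntegral _ _ 0, zero_add, hlift, hsplit,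
    intervalIntegral.integral_sub (hint n) (hint (n - 1)), integral_exp_mul_sin hw,
    integral_exp_mul_sin hw, real_smul]
  push_cast
  field_simp
  ring

lemma hasSum_sineCoeff_sub_mul_exp {w : ℂ} (hw : w ∈ integerComplement) {x : ℝ}
    (hx : x ∈ Set.Ico 0 (2 * Real.pi)) :
    HasSum (fun n : ℤ => -I * sin (w * Real.pi) / Real.pi *
      ((sineCoeff w n - sineCoeff w (n - 1)) * exp (n * x * I)))
      ((1 - exp (x * I)) * sin (w * (Real.pi - x))) := by
  have hs : Summable (fourierCoeff (circleSine w)) := by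
    simpa only [funext (fourierCoeff_circleSine hw)] using (summable_sineCoeff_sub hw).mul_left _
  have h := has_pointwise_sum_fourier_series_of_summable hs x
  simpa only [fourierCoeff_circleSine hw, fourier_two_pi_apply, circleSine_coe_apply w hx,
    smul_eq_mul, mul_assoc] using h

/-- Summation by parts for a sine polynomial with coefficients `sineCoeff`. -/
lemma sum_sineCoeff_mul_sin (w : ℂ) (x : ℝ) (N : ℕ) :
    2 * I * (1 - exp (x * I)) * ∑ k ∈ Finset.Icc 1 N, sineCoeff w k * sin (k * x) =
      ∑ n ∈ Finset.range (N + 1),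
        ((sineCoeff w n - sineCoeff w (n - 1)) * exp ((n : ℤ) * x * I) +
        (sineCoeff w (-n) - sineCoeff w (-n - 1)) * exp ((-n : ℤ) * x * I)) -
      (sineCoeff w 0 - sineCoeff w (0 - 1)) * exp ((0 : ℤ) * x * I) -
      sineCoeff w (N + 1 : ℕ) * exp (-(N * x * I)) - sineCoeff w N * exp ((N + 1) * x * I) := by
  have hsub (n : ℕ) : sineCoeff w (-n - 1) = -sineCoeff w (n + 1 : ℕ) := by
    rw [← sineCoeff_neg]; push_cast; ring_nf
  have h0 : sineCoeff w 0 = 0 := by simp [sineCoeff]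
  induction N with
  | zero => simp [h0, sineCoeff_neg]
  | succ N ih =>
    rw [Finset.sum_Icc_succ_top (by omega), Finset.sum_range_succ, mul_add, ih, hsub,
      sineCoeff_neg]
    have hs : 2 * I * sin ((N + 1 : ℕ) * x) =
        exp ((N + 1) * x * I) - exp (-((N + 1) * x * I)) := by
      rw [sin]
      push_cast
      rw [neg_mul]
      linear_combination (exp (-((N + 1) * x * I)) - exp ((N + 1) * x * I)) * I_sq
    have hexp_succ : exp (((N + 1 : ℕ) + 1) * x * I) = exp (x * I) * exp ((N + 1) * x * I) := by
      rw [← exp_add]; push_cast; ring_nf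
    have hexp_pred : exp (-(N * x * I)) = exp (x * I) * exp (-((N + 1) * x * I)) := by
      rw [← exp_add]; ring_nf
    rw [hexp_succ, hexp_pred]
    have hpred : ((N + 1 : ℕ) : ℤ) - 1 = N := by push_cast; ring
    rw [hpred]
    have hexp_neg : exp (((-(N + 1 : ℕ) : ℤ) : ℂ) * x * I) = exp (-((N + 1) * x * I)) := by
      push_cast; ring_nf
    have hexp_pos : exp ((((N + 1 : ℕ) : ℤ) : ℂ) * x * I) = exp ((N + 1) * x * I) := by
      push_cast; ring_nf
    have hexp_neg_cast : exp (-(((N + 1 : ℕ) : ℂ) * x * I)) = exp (-((N + 1) * x * I)) := by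
      push_cast; ring_nf
    rw [hexp_neg, hexp_pos, hexp_neg_cast]
    linear_combination (1 - exp (x * I)) * sineCoeff w (N + 1 : ℕ) * hs

/-- The Fourier sine expansion of `sin (w (π - x))` for non-integral `w`. -/
theorem tendsto_sum_sineCoeff_mul_sin {w : ℂ} (hw : w ∈ integerComplement) {x : ℝ}
    (hx : x ∈ Set.Ioo 0 (2 * Real.pi)) :
    Tendsto (fun N : ℕ => ∑ k ∈ Finset.Icc 1 N, sineCoeff w k * sin (k * x)) atTop
      (nhds (Real.pi / 2 * sin (w * (Real.pi - x)) / sin (w * Real.pi))) := by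
  have hπ : (Real.pi : ℂ) ≠ 0 := ofReal_ne_zero.2 Real.pi_ne_zero
  have hsin : sin (w * Real.pi) ≠ 0 := by
    simpa [mul_comm] using sin_pi_mul_ne_zero hw
  have hq : 1 - exp (x * I) ≠ 0 := by
    intro h
    obtain ⟨n, hn⟩ := exp_eq_one_iff.1 (sub_eq_zero.1 h).symm
    have hxn : x = n * (2 * Real.pi) := by
      apply ofReal_injective
      apply mul_right_cancel₀ I_ne_zero
      rw [hn]; push_cast; ring
    have h1 : (0 : ℝ) < n := by
      by_contra! hle
      nlinarith [hx.1, Real.pi_pos]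
    have h2 : (n : ℝ) < 1 := by
      by_contra! hle
      nlinarith [hx.2, Real.pi_pos]
    norm_cast at h1 h2
    omega
  have hc : -I * sin (w * Real.pi) / Real.pi ≠ 0 :=
    div_ne_zero (mul_ne_zero (neg_ne_zero.2 I_ne_zero) hsin) hπ
  have hsum := (((hasSum_sineCoeff_sub_mul_exp hw (Set.Ioo_subset_Ico_self hx)).mul_left
    (-I * sin (w * Real.pi) / Real.pi)⁻¹).congr_fun
      (fun n => (inv_mul_cancel_left₀ hc _).symm)).nat_add_neg
  have hlim := hsum.tendsto_sum_nat.comp (tendsto_add_atTop_nat 1)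
  have hnorm (y : ℝ) : ‖exp (y * I)‖ ≤ 1 := (norm_exp_ofReal_mul_I y).le
  have hexp_pred₁ : Tendsto (fun N : ℕ => sineCoeff w (N + 1 : ℕ) * exp (-(N * x * I))) atTop
      (nhds 0) :=
    ((tendsto_sineCoeff_natCast hw).comp (tendsto_add_atTop_nat 1)).zero_mul_isBoundedUnder_le
      (isBoundedUnder_of ⟨1, fun N => by simpa using hnorm (-(N * x))⟩)
  have hexp_pred₂ : Tendsto (fun N : ℕ => sineCoeff w N * exp ((N + 1) * x * I)) atTop (nhds 0) :=
    (tendsto_sineCoeff_natCast hw).zero_mul_isBoundedUnder_le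
      (isBoundedUnder_of ⟨1, fun N => by simpa using hnorm ((N + 1) * x)⟩)
  have hlim' := (((hlim.sub_const ((sineCoeff w 0 - sineCoeff w (0 - 1)) *
    exp ((0 : ℤ) * x * I))).sub hexp_pred₁).sub hexp_pred₂).const_mul (2 * I * (1 - exp (x * I)))⁻¹
  have hne : 2 * I * (1 - exp (x * I)) ≠ 0 := by simp [hq]
  convert hlim' using 1
  · ext N
    rw [eq_inv_mul_iff_mul_eq₀ hne, sum_sineCoeff_mul_sin]
    rfl
  · congr 1
    rw [eq_inv_mul_iff_mul_eq₀ hne]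
    simp only [add_sub_cancel_right, sub_zero]
    generalize sin (w * Real.pi) = s at hsin ⊢
    generalize exp (x * I) = q
    field_simp
    linear_combination (1 - q) * sin (w * (Real.pi - x)) * I_sq

lemma exp_I_mul_pi_div_four_sq : exp (I * Real.pi / 4) ^ 2 = I := by
  rw [← exp_nat_mul,
    show ((2 : ℕ) : ℂ) * (I * Real.pi / 4) = Real.pi / 2 * I by push_cast; ring,
    exp_pi_div_two_mul_I]

lemma mem_integerComplement_of_sq_eq_I_mul {w : ℂ} {r : ℝ} (hr : r ≠ 0) (hw : w ^ 2 = I * r) :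
    w ∈ integerComplement := by
  rintro ⟨n, rfl⟩
  apply hr
  simpa [sq] using (congrArg im hw).symm

/-- Lemma expansion-s: the Fourier sine expansion on (0, π) of
x ↦ sin(c·a·(π − x)) with c = exp(iπ/4), together with sin(c·a·π) ≠ 0. -/
theorem fourier_sine_expansion_complex (a : ℝ) (ha : 0 < a) :
    Complex.sin (Complex.exp (Complex.I * Real.pi / 4) * a * Real.pi) ≠ 0 ∧
    ∀ x ∈ Set.Ioo (0:ℝ) Real.pi,
      Tendsto (fun n : ℕ => ∑ k ∈ Finset.Icc 1 n,
          (((k:ℂ)^3 + Complex.I * (k:ℂ) * (a:ℂ)^2) / ((k:ℂ)^4 + (a:ℂ)^4))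
            * (Real.sin (k * x) : ℂ))
        atTop
        (nhds ((Real.pi / 2 : ℂ)
          * Complex.sin (Complex.exp (Complex.I * Real.pi / 4) * a * ((Real.pi : ℂ) - x))
          / Complex.sin (Complex.exp (Complex.I * Real.pi / 4) * a * Real.pi))) := by
  have hsq : (exp (I * Real.pi / 4) * a) ^ 2 = I * (a ^ 2 : ℝ) := by
    rw [mul_pow, exp_I_mul_pi_div_four_sq]
    push_cast
    rfl
  have hw := mem_integerComplement_of_sq_eq_I_mul (pow_pos ha 2).ne' hsq
  refine ⟨by simpa [mul_comm] using sin_pi_mul_ne_zero hw, fun x hx => ?_⟩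
  refine (tendsto_sum_sineCoeff_mul_sin hw
    ⟨hx.1, hx.2.trans (by linarith [Real.pi_pos])⟩).congr fun n => ?_
  refine Finset.sum_congr rfl fun k _ => ?_
  have hplus : (k : ℂ) ^ 2 + I * a ^ 2 ≠ 0 := fun h => by
    simpa [sq, ha.ne'] using congrArg im h
  have hfac : (k : ℂ) ^ 4 + (a : ℂ) ^ 4 =
      ((k : ℂ) ^ 2 - I * a ^ 2) * ((k : ℂ) ^ 2 + I * a ^ 2) := by
    linear_combination (a : ℂ) ^ 4 * I_sq
  rw [sineCoeff, hsq, hfac]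
  push_cast
  rw [show (k : ℂ) ^ 3 + I * k * a ^ 2 = k * ((k : ℂ) ^ 2 + I * a ^ 2) by ring,
    mul_div_mul_right _ _ hplus]
end
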